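/- Fix probability vectors p = (p_w, p_d, p_ℓ) and q = (q_w, q_d, q_ℓ), and assume the defensive style is safe, i.e. q_d = 1, with 0 < p_ℓ and p_w ≤ p_ℓ. Then g_N^(cat+) → 2·p_w/p_ℓ − 1 as N → ∞, i.e. catenaccio+ has the same asymptotic gain as catenaccio. -/

import Mathlib

noncomputable section

open Filter Topology Finset

/-- The sign of an integer score, as a real number (`sgn 0 = 0`). -/
def sgn (x : ℤ) : ℝ := if 0 < x then 1 else if x < 0 then -1 else 0

/-- Expected sign of the score after one more game played with win/draw/loss
probabilities `w, d, l`, starting from score `x`. -/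
def stepVal (w d l : ℝ) (x : ℤ) : ℝ := w * sgn (x + 1) + d * sgn x + l * sgn (x - 1)

/-- Bellman value function with `k` games remaining: `bellman p q k x = V_{N-k}^N(x)`.
With no game remaining the value is the sign of the score; otherwise Player 1 picks the
better of the offensive style `(pw, pd, pl)` and the defensive style `(qw, qd, ql)`. -/
def bellman (pw pd pl qw qd ql : ℝ) : ℕ → ℤ → ℝ
  | 0, x => sgn x
  | k + 1, x =>
      max
        (pw * bellman pw pd pl qw qd ql k (x + 1) + pd * bellman pw pd pl qw qd ql k x +
          pl * bellman pw pd pl qw qd ql k (x - 1))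
        (qw * bellman pw pd pl qw qd ql k (x + 1) + qd * bellman pw pd pl qw qd ql k x +
          ql * bellman pw pd pl qw qd ql k (x - 1))

/-- Optimal gain over `N` games: `g*_N = V_0^N(0)`. -/
def gOpt (pw pd pl qw qd ql : ℝ) (N : ℕ) : ℝ := bellman pw pd pl qw qd ql N 0

/-- The two playing styles of Player 1. -/
inductive Style
  | offense
  | defense
deriving DecidableEq

/-- Selects the probability attached to a style: `a` for offense, `b` for defense. -/
def styleP (a b : ℝ) : Style → ℝ
  | .offense => a
  | .defense => b

/-- Probability mass function of the score process `X_n` under the policy `π`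
(playing `π n x` at round `n+1` when the current score is `x`), started at `X_0 = 0`. -/
def polDist (pw pd pl qw qd ql : ℝ) (π : ℕ → ℤ → Style) : ℕ → ℤ → ℝ
  | 0, x => if x = 0 then 1 else 0
  | n + 1, x =>
      polDist pw pd pl qw qd ql π n (x - 1) * styleP pw qw (π n (x - 1)) +
      polDist pw pd pl qw qd ql π n x * styleP pd qd (π n x) +
      polDist pw pd pl qw qd ql π n (x + 1) * styleP pl ql (π n (x + 1))

/-- Gain of policy `π` over `n` games: `g_n^π = E[sign (X_n)]`. -/
def gPol (pw pd pl qw qd ql : ℝ) (π : ℕ → ℤ → Style) (n : ℕ) : ℝ :=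
  ∑' x : ℤ, polDist pw pd pl qw qd ql π n x * sgn x

/-- Probability mass function of the pair (score, switched-to-defense flag) under the
catenaccio policy: play offense until the score first reaches `+1`, then defense forever. -/
def catDist (pw pd pl qw qd ql : ℝ) : ℕ → ℤ → Bool → ℝ
  | 0, x, b => if x = 0 ∧ b = false then 1 else 0
  | n + 1, x, true =>
      catDist pw pd pl qw qd ql n (x - 1) true * qw +
      catDist pw pd pl qw qd ql n x true * qd +
      catDist pw pd pl qw qd ql n (x + 1) true * ql +
      (if x = 1 then
        catDist pw pd pl qw qd ql n 0 false * pw +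
        catDist pw pd pl qw qd ql n 1 false * pd +
        catDist pw pd pl qw qd ql n 2 false * pl
       else 0)
  | n + 1, x, false =>
      if x = 1 then 0
      else
        catDist pw pd pl qw qd ql n (x - 1) false * pw +
        catDist pw pd pl qw qd ql n x false * pd +
        catDist pw pd pl qw qd ql n (x + 1) false * pl

/-- Gain of the catenaccio policy over `N` games: `g_N^(cat) = E[sign (X_N)]`. -/
def gCat (pw pd pl qw qd ql : ℝ) (N : ℕ) : ℝ :=
  ∑' x : ℤ,
    (catDist pw pd pl qw qd ql N x false + catDist pw pd pl qw qd ql N x true) * sgn x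

/-- Gain of the catenaccio+ policy over `N` games: play catenaccio, except that if the
score after `N - 1` games is `0`, the last game is played with the better of the two
styles (offense if `pw - pl > qw - ql`, defense otherwise). -/
def gCatPlus (pw pd pl qw qd ql : ℝ) : ℕ → ℝ
  | 0 => 0
  | N + 1 =>
      ∑' x : ℤ,
        (catDist pw pd pl qw qd ql N x false *
            (if x = 0 then (if pw - pl > qw - ql then pw - pl else qw - ql)
             else stepVal pw pd pl x) +
          catDist pw pd pl qw qd ql N x true *
            (if x = 0 then (if pw - pl > qw - ql then pw - pl else qw - ql)
             else stepVal qw qd ql x))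

/-- Probability mass function of the lazy random walk with i.i.d. increments (+1 with
probability `qw`, 0 with probability `qd`, −1 with probability `ql`), started at `0`. -/
def walkDist (qw qd ql : ℝ) : ℕ → ℤ → ℝ
  | 0, x => if x = 0 then 1 else 0
  | n + 1, x =>
      walkDist qw qd ql n (x - 1) * qw + walkDist qw qd ql n x * qd +
        walkDist qw qd ql n (x + 1) * ql

/-- Fixed-style gain over `N` games for the walk with step law `(qw, qd, ql)`. -/
def gFixed (qw qd ql : ℝ) (N : ℕ) : ℝ := ∑' x : ℤ, walkDist qw qd ql N x * sgn x

/-- Probability mass function of the lazy random walk with step law `(pw, pd, pl)`,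
started at `0` and absorbed (stopped) at the level `+1`.  In particular
`stoppedDist pw pd pl n 1` is the probability that the walk reaches `+1` by time `n`. -/
def stoppedDist (pw pd pl : ℝ) : ℕ → ℤ → ℝ
  | 0, x => if x = 0 then 1 else 0
  | n + 1, x =>
      if x = 1 then
        stoppedDist pw pd pl n 1 + stoppedDist pw pd pl n 0 * pw +
          stoppedDist pw pd pl n 2 * pl
      else
        (if x - 1 = 1 then 0 else stoppedDist pw pd pl n (x - 1) * pw) +
          stoppedDist pw pd pl n x * pd +
          (if x + 1 = 1 then 0 else stoppedDist pw pd pl n (x + 1) * pl)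

/-- Probability that a player following catenaccio has never led and trails by `k` after
`n` games. -/
def trailDist (pw pd pl : ℝ) (n k : ℕ) : ℝ := catDist pw pd pl 0 1 0 n (-(k : ℤ)) false

/-- Probability that a player following catenaccio with a safe defense leads after `n` games. -/
def leadProb (pw pd pl : ℝ) (n : ℕ) : ℝ := catDist pw pd pl 0 1 0 n 1 true

theorem catDist_false_of_pos (pw pd pl qw qd ql : ℝ) (n : ℕ) :
    ∀ x : ℤ, 0 < x → catDist pw pd pl qw qd ql n x false = 0 := by
  induction n with
  | zero => intro x hx; simp [catDist, hx.ne']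
  | succ n ih =>
    intro x hx
    rw [catDist]
    split_ifs with h
    · rfl
    · rw [ih (x - 1) (by omega), ih x hx, ih (x + 1) (by omega)]
      ring

theorem catDist_true_of_ne_one (pw pd pl : ℝ) (n : ℕ) (x : ℤ) (hx : x ≠ 1) :
    catDist pw pd pl 0 1 0 n x true = 0 := by
  induction n with
  | zero => simp [catDist]
  | succ n ih => simp [catDist, ih, hx]

theorem leadProb_zero (pw pd pl : ℝ) : leadProb pw pd pl 0 = 0 := by
  simp [leadProb, catDist]

theorem leadProb_succ (pw pd pl : ℝ) (n : ℕ) :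
    leadProb pw pd pl (n + 1) = leadProb pw pd pl n + pw * trailDist pw pd pl n 0 := by
  simp [leadProb, trailDist, catDist, catDist_false_of_pos, mul_comm]

theorem trailDist_zero (pw pd pl : ℝ) (k : ℕ) :
    trailDist pw pd pl 0 k = if k = 0 then 1 else 0 := by
  simp [trailDist, catDist]

theorem trailDist_succ_zero (pw pd pl : ℝ) (n : ℕ) :
    trailDist pw pd pl (n + 1) 0 =
      pd * trailDist pw pd pl n 0 + pw * trailDist pw pd pl n 1 := by
  simp [trailDist, catDist, catDist_false_of_pos]
  ring

theorem trailDist_succ_succ (pw pd pl : ℝ) (n k : ℕ) :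
    trailDist pw pd pl (n + 1) (k + 1) =
      pw * trailDist pw pd pl n (k + 2) + pd * trailDist pw pd pl n (k + 1) +
        pl * trailDist pw pd pl n k := by
  have h : (-((k + 1 : ℕ) : ℤ)) ≠ 1 := by omega
  have h₁ : (-((k + 1 : ℕ) : ℤ)) - 1 = -((k + 2 : ℕ) : ℤ) := by push_cast; ring
  have h₂ : (-((k + 1 : ℕ) : ℤ)) + 1 = -(k : ℤ) := by push_cast; ring
  simp only [trailDist]
  rw [catDist, if_neg h, h₁, h₂]
  ring

theorem trailDist_nonneg {pw pd pl : ℝ} (hpw : 0 ≤ pw) (hpd : 0 ≤ pd) (hpl : 0 ≤ pl)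
    (n : ℕ) : ∀ k, 0 ≤ trailDist pw pd pl n k := by
  induction n with
  | zero => intro k; rw [trailDist_zero]; split_ifs <;> norm_num
  | succ n ih =>
    rintro (_ | k)
    · rw [trailDist_succ_zero]
      have := ih 0
      have := ih 1
      positivity
    · rw [trailDist_succ_succ]
      have := ih k
      have := ih (k + 1)
      have := ih (k + 2)
      positivity

theorem trailDist_eq_zero_of_lt (pw pd pl : ℝ) (n : ℕ) :
    ∀ k, n < k → trailDist pw pd pl n k = 0 := by
  induction n with
  | zero => intro k hk; simp [trailDist_zero, hk.ne']
  | succ n ih =>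
    rintro (_ | k) hk
    · omega
    · rw [trailDist_succ_succ, ih k (by omega), ih (k + 1) (by omega), ih (k + 2) (by omega)]
      ring

theorem sum_trailDist_succ_aux {pw pd pl : ℝ} (hp : pw + pd + pl = 1) (a : ℝ) (n m : ℕ) :
    ∑ k ∈ range (m + 1), trailDist pw pd pl (n + 1) k * a ^ (k + 1) =
      ∑ k ∈ range (m + 1), trailDist pw pd pl n k * a ^ (k + 1) +
        (1 - a) * (pw - pl * a) * ∑ k ∈ range (m + 1), trailDist pw pd pl n k * a ^ k -
        pw * trailDist pw pd pl n 0 + pw * trailDist pw pd pl n (m + 1) * a ^ (m + 1) -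
        pl * trailDist pw pd pl n m * a ^ (m + 2) := by
  obtain rfl : pd = 1 - pw - pl := by linarith
  induction m with
  | zero =>
    simp [trailDist_succ_zero]
    ring
  | succ m ih =>
    rw [sum_range_succ, ih, sum_range_succ _ (m + 1), sum_range_succ _ (m + 1),
      trailDist_succ_succ]
    ring

/-- Evolution of the exponential functional of the stopped score. -/
theorem leadProb_add_sum_succ {pw pd pl : ℝ} (hp : pw + pd + pl = 1) (a : ℝ) {n m : ℕ}
    (h : n < m) :
    leadProb pw pd pl (n + 1) +
        ∑ k ∈ range (m + 1), trailDist pw pd pl (n + 1) k * a ^ (k + 1) =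
      leadProb pw pd pl n + ∑ k ∈ range (m + 1), trailDist pw pd pl n k * a ^ (k + 1) +
        (1 - a) * (pw - pl * a) * ∑ k ∈ range (m + 1), trailDist pw pd pl n k * a ^ k := by
  rw [sum_trailDist_succ_aux hp, leadProb_succ, trailDist_eq_zero_of_lt _ _ _ n m h,
    trailDist_eq_zero_of_lt _ _ _ n (m + 1) (by omega)]
  ring

theorem leadProb_add_sum_zero (pw pd pl a : ℝ) (m : ℕ) :
    leadProb pw pd pl 0 + ∑ k ∈ range (m + 1), trailDist pw pd pl 0 k * a ^ (k + 1) = a := by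
  rw [sum_range_succ']
  simp [trailDist_zero, leadProb_zero]

theorem leadProb_add_sum_eq {pw pd pl : ℝ} (hp : pw + pd + pl = 1) {a : ℝ}
    (ha : (1 - a) * (pw - pl * a) = 0) {n m : ℕ} (h : n ≤ m) :
    leadProb pw pd pl n + ∑ k ∈ range (m + 1), trailDist pw pd pl n k * a ^ (k + 1) = a := by
  induction n with
  | zero => exact leadProb_add_sum_zero ..
  | succ n ih => rw [leadProb_add_sum_succ hp a (by omega), ha, ih (by omega)]; ring

theorem le_leadProb_add_sum {pw pd pl : ℝ} (hpw : 0 ≤ pw) (hpd : 0 ≤ pd) (hpl : 0 ≤ pl)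
    (hp : pw + pd + pl = 1) {a : ℝ} (ha₀ : 0 ≤ a)
    (ha : 0 ≤ (1 - a) * (pw - pl * a)) {n m : ℕ} (h : n ≤ m) :
    a ≤ leadProb pw pd pl n +
      ∑ k ∈ range (m + 1), trailDist pw pd pl n k * a ^ (k + 1) := by
  induction n with
  | zero => exact (leadProb_add_sum_zero ..).ge
  | succ n ih =>
    rw [leadProb_add_sum_succ hp a (by omega)]
    have := ih (by omega)
    have : 0 ≤ ∑ k ∈ range (m + 1), trailDist pw pd pl n k * a ^ k :=
      sum_nonneg fun k _ => mul_nonneg (trailDist_nonneg hpw hpd hpl n k) (pow_nonneg ha₀ k)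
    have := mul_nonneg ha this
    linarith

theorem leadProb_add_sum_trailDist {pw pd pl : ℝ} (hp : pw + pd + pl = 1) {n m : ℕ}
    (h : n ≤ m) :
    leadProb pw pd pl n + ∑ k ∈ range (m + 1), trailDist pw pd pl n k = 1 := by
  simpa using leadProb_add_sum_eq hp (a := 1) (by ring) h

theorem leadProb_monotone {pw pd pl : ℝ} (hpw : 0 ≤ pw) (hpd : 0 ≤ pd) (hpl : 0 ≤ pl) :
    Monotone (leadProb pw pd pl) :=
  monotone_nat_of_le_succ fun n => by
    rw [leadProb_succ]
    exact le_add_of_nonneg_right (mul_nonneg hpw (trailDist_nonneg hpw hpd hpl n 0))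

theorem leadProb_le {pw pd pl : ℝ} (hpw : 0 ≤ pw) (hpd : 0 ≤ pd) (hpl : 0 < pl)
    (hp : pw + pd + pl = 1) (n : ℕ) : leadProb pw pd pl n ≤ pw / pl := by
  have ha : (1 - pw / pl) * (pw - pl * (pw / pl)) = 0 := by
    rw [mul_div_cancel₀ _ hpl.ne']; ring
  rw [← leadProb_add_sum_eq hp ha le_rfl]
  exact le_add_of_nonneg_right <| sum_nonneg fun k _ =>
    mul_nonneg (trailDist_nonneg hpw hpd hpl.le n k) (by positivity)

theorem tendsto_trailDist {pw pd pl L : ℝ} (hpw : 0 < pw)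
    (hL : Tendsto (leadProb pw pd pl) atTop (𝓝 L)) (k : ℕ) :
    Tendsto (fun n => trailDist pw pd pl n k) atTop (𝓝 0) := by
  have h₀ : Tendsto (fun n => trailDist pw pd pl n 0) atTop (𝓝 0) := by
    have h := (((tendsto_add_atTop_iff_nat 1).2 hL).sub hL).div_const pw
    rw [sub_self, zero_div] at h
    refine h.congr fun n => ?_
    rw [leadProb_succ]
    field_simp
    ring
  have h₁ : Tendsto (fun n => trailDist pw pd pl n 1) atTop (𝓝 0) := by
    have h := (((tendsto_add_atTop_iff_nat 1).2 h₀).sub (h₀.const_mul pd)).div_const pw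
    rw [mul_zero, sub_self, zero_div] at h
    refine h.congr fun n => ?_
    rw [trailDist_succ_zero]
    field_simp
    ring
  induction k using Nat.twoStepInduction with
  | zero => exact h₀
  | one => exact h₁
  | more k ih₀ ih₁ =>
    have h := ((((tendsto_add_atTop_iff_nat 1).2 ih₁).sub (ih₁.const_mul pd)).sub
      (ih₀.const_mul pl)).div_const pw
    simp only [mul_zero, sub_self, zero_div] at h
    refine h.congr fun n => ?_
    rw [trailDist_succ_succ]
    field_simp
    ring

theorem sum_trailDist_mul_pow_le {pw pd pl : ℝ} (hpw : 0 ≤ pw) (hpd : 0 ≤ pd) (hpl : 0 ≤ pl)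
    (hp : pw + pd + pl = 1) {a : ℝ} (ha₀ : 0 ≤ a) (ha₁ : a ≤ 1) (n K : ℕ) :
    ∑ k ∈ range (n + 1), trailDist pw pd pl n k * a ^ (k + 1) ≤
      ∑ k ∈ range K, trailDist pw pd pl n k + a ^ K := by
  have hf := trailDist_nonneg hpw hpd hpl n
  have hT : 0 ≤ leadProb pw pd pl n :=
    (leadProb_zero pw pd pl).ge.trans (leadProb_monotone hpw hpd hpl n.zero_le)
  have htot := leadProb_add_sum_trailDist hp (Nat.le_add_right n K)
  calc
    _ ≤ ∑ k ∈ range (n + K + 1), trailDist pw pd pl n k * a ^ (k + 1) :=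
      sum_le_sum_of_subset_of_nonneg (range_mono (by omega)) fun k _ _ =>
        mul_nonneg (hf k) (pow_nonneg ha₀ _)
    _ ≤ ∑ k ∈ range (n + K + 1),
        ((if k ∈ range K then trailDist pw pd pl n k else 0) + a ^ K * trailDist pw pd pl n k) := by
      refine sum_le_sum fun k _ => ?_
      split_ifs with hk
      · exact (mul_le_of_le_one_right (hf k) (pow_le_one₀ ha₀ ha₁)).trans
          (le_add_of_nonneg_right (mul_nonneg (pow_nonneg ha₀ K) (hf k)))
      · rw [zero_add, mul_comm]
        rw [mem_range, not_lt] at hk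
        exact mul_le_mul_of_nonneg_right (pow_le_pow_of_le_one ha₀ ha₁ (by omega)) (hf k)
    _ ≤ ∑ k ∈ range K, trailDist pw pd pl n k + a ^ K := by
      rw [sum_add_distrib, ← mul_sum, sum_ite_mem,
        inter_eq_right.2 (range_mono (show K ≤ n + K + 1 by omega))]
      gcongr
      exact mul_le_of_le_one_right (pow_nonneg ha₀ K) (by linarith)

theorem tendsto_leadProb {pw pd pl : ℝ} (hpw : 0 < pw) (hpd : 0 ≤ pd) (hpl : 0 < pl)
    (hp : pw + pd + pl = 1) (hweak : pw ≤ pl) :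
    Tendsto (leadProb pw pd pl) atTop (𝓝 (pw / pl)) := by
  obtain ⟨L, hL⟩ : ∃ L, Tendsto (leadProb pw pd pl) atTop (𝓝 L) :=
    ⟨_, tendsto_atTop_ciSup (leadProb_monotone hpw.le hpd hpl.le)
      ⟨pw / pl, Set.forall_mem_range.2 (leadProb_le hpw.le hpd hpl hp)⟩⟩
  have hle : L ≤ pw / pl := le_of_tendsto' hL (leadProb_le hpw.le hpd hpl hp)
  have hL₀ : 0 ≤ L := (leadProb_zero pw pd pl).ge.trans
    ((leadProb_monotone hpw.le hpd hpl.le).ge_of_tendsto hL 0)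
  have hge : pw / pl ≤ L := by
    refine le_of_forall_lt_imp_le_of_dense fun a ha => ?_
    rcases le_or_gt a 0 with ha₀ | ha₀
    · exact ha₀.trans hL₀
    have ha₁ : a < 1 := ha.trans_le ((div_le_one hpl).2 hweak)
    have hdrift : 0 ≤ (1 - a) * (pw - pl * a) := by
      rw [lt_div_iff₀ hpl] at ha
      exact mul_nonneg (by linarith) (by linarith)
    have hK (K : ℕ) : a ≤ L + (0 + a ^ K) := by
      have hsum : Tendsto (fun n => ∑ k ∈ range K, trailDist pw pd pl n k) atTop (𝓝 0) := by
        simpa using tendsto_finsetSum (range K) fun k _ => tendsto_trailDist hpw hL k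
      refine ge_of_tendsto' (hL.add (hsum.add_const (a ^ K))) fun n => ?_
      exact (le_leadProb_add_sum hpw.le hpd hpl.le hp ha₀.le hdrift le_rfl).trans
        (add_le_add_right (sum_trailDist_mul_pow_le hpw.le hpd hpl.le hp ha₀.le ha₁.le n K) _)
    refine ge_of_tendsto' (x := atTop) ?_ hK
    simpa using (tendsto_pow_atTop_nhds_zero_of_lt_one ha₀.le ha₁).const_add L
  rwa [le_antisymm hle hge] at hL

theorem stepVal_of_le_neg_two {w d l : ℝ} (h : w + d + l = 1) {x : ℤ} (hx : x ≤ -2) :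
    stepVal w d l x = -1 := by
  rw [stepVal, sgn, sgn, sgn, if_neg (by omega), if_pos (by omega), if_neg (by omega),
    if_pos (by omega), if_neg (by omega), if_pos (by omega)]
  linarith

theorem gCatPlus_succ_of_safe_defense {pw pd pl : ℝ} (hp : pw + pd + pl = 1)
    (hweak : pw ≤ pl) (N : ℕ) :
    gCatPlus pw pd pl 0 1 0 (N + 1) =
      2 * leadProb pw pd pl N - 1 + trailDist pw pd pl N 0 + pw * trailDist pw pd pl N 1 := by
  have hinj : Function.Injective fun k : ℕ => -(k : ℤ) := fun i j h => by
    simpa using h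
  rw [gCatPlus, tsum_eq_sum (s := insert 1 ((range (N + 2)).image fun k : ℕ => -(k : ℤ)))]
  · rw [sum_insert (by simp; omega), sum_image hinj.injOn, sum_range_succ', sum_range_succ']
    have htot := leadProb_add_sum_trailDist hp (Nat.le_succ N)
    rw [sum_range_succ', sum_range_succ'] at htot
    have hrest : ∀ k ∈ range N,
        catDist pw pd pl 0 1 0 N (-((k + 1 + 1 : ℕ) : ℤ)) false *
            (if (-((k + 1 + 1 : ℕ) : ℤ)) = 0 then
              (if pw - pl > 0 - 0 then pw - pl else 0 - 0)
             else stepVal pw pd pl (-((k + 1 + 1 : ℕ) : ℤ))) +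
          catDist pw pd pl 0 1 0 N (-((k + 1 + 1 : ℕ) : ℤ)) true *
            (if (-((k + 1 + 1 : ℕ) : ℤ)) = 0 then
              (if pw - pl > 0 - 0 then pw - pl else 0 - 0)
             else stepVal 0 1 0 (-((k + 1 + 1 : ℕ) : ℤ))) =
        -trailDist pw pd pl N (k + 1 + 1) := by
      intro k _
      rw [catDist_true_of_ne_one _ _ _ _ _ (by omega), if_neg (by omega),
        stepVal_of_le_neg_two hp (by omega), trailDist]
      ring
    rw [sum_congr rfl hrest, sum_neg_distrib]
    simp only [trailDist, leadProb] at htot ⊢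
    norm_num [stepVal, sgn, catDist_false_of_pos, catDist_true_of_ne_one, hweak.not_gt] at htot ⊢
    linear_combination (-1) * htot - catDist pw pd pl 0 1 0 N (-1) false * hp
  · intro x hx
    simp only [mem_insert, mem_image, mem_range, not_or, not_exists, not_and] at hx
    have hfalse : catDist pw pd pl 0 1 0 N x false = 0 := by
      rcases lt_or_ge 0 x with h | h
      · exact catDist_false_of_pos _ _ _ _ _ _ _ _ h
      · obtain ⟨k, rfl⟩ : ∃ k : ℕ, x = -(k : ℤ) := ⟨x.natAbs, by omega⟩
        refine trailDist_eq_zero_of_lt _ _ _ N k ?_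
        by_contra! hk
        exact hx.2 k (by omega) rfl
    rw [hfalse, catDist_true_of_ne_one _ _ _ _ _ hx.1]
    ring

/-- If the defensive style is safe (`qd = 1`), `0 < pl` and `pw ≤ pl`,
then `g_N^(cat+) → 2 pw / pl − 1` as `N → ∞`: catenaccio+ has the same asymptotic gain
as catenaccio. -/
theorem catenaccioPlus_gain_tendsto_of_safe_defense
    (pw pd pl qw qd ql : ℝ)
    (hpw : 0 ≤ pw) (hpd : 0 ≤ pd) (hpl : 0 ≤ pl) (hp : pw + pd + pl = 1)
    (hqw : 0 ≤ qw) (hqd : 0 ≤ qd) (hql : 0 ≤ ql) (hq : qw + qd + ql = 1)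
    (hsafe : qd = 1) (hpl0 : 0 < pl) (hweak : pw ≤ pl) :
    Tendsto (fun N : ℕ => gCatPlus pw pd pl qw qd ql N) atTop
      (𝓝 (2 * pw / pl - 1)) := by
  subst hsafe
  obtain rfl : qw = 0 := by linarith
  obtain rfl : ql = 0 := by linarith
  rw [← tendsto_add_atTop_iff_nat 1]
  simp only [gCatPlus_succ_of_safe_defense hp hweak]
  rcases hpw.eq_or_lt with rfl | hpw₀
  · have hlead (n : ℕ) : leadProb 0 pd pl n = 0 := by
      induction n with
      | zero => exact leadProb_zero ..
      | succ n ih => rw [leadProb_succ, ih]; ring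
    have htrail (n : ℕ) : trailDist 0 pd pl n 0 = pd ^ n := by
      induction n with
      | zero => simp [trailDist_zero]
      | succ n ih => rw [trailDist_succ_zero, ih]; ring
    simp only [hlead, htrail]
    simpa using (tendsto_pow_atTop_nhds_zero_of_lt_one hpd (by linarith)).const_add (-1)
  · have hL := tendsto_leadProb hpw₀ hpd hpl0 hp hweak
    have h := (((hL.const_mul 2).sub_const 1).add (tendsto_trailDist hpw₀ hL 0)).add
      ((tendsto_trailDist hpw₀ hL 1).const_mul pw)
    simpa [mul_div_assoc] using h
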